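/- Assume r ∈ [0,1] is fixed, α is strictly increasing on (a,b), β ∈ BV_loc((a,b),ℝ), and θ_{1−r}(x) ≠ 0 and θ_r(x) ≠ 0 for all x ∈ (a,b). Let u and v be r-balanced solutions of −d(dy/dα) + y dβ = 0 on (a,b). Then for all x < y in (a,b), W^-[u,v](y) = W^-[u,v](x) · ∏_{t ∈ [x,y)} θ(t), where the product is over the (at most countably many) points t ∈ [x,y) with θ(t) ≠ 1 (the product converges since θ(t) = 1 except at countably many points and differs from 1 summably on compact sets). -/

import Mathlib

open Set Filter Function MeasureTheory Topology

noncomputable section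

/-- The open interval `(a,b) ⊆ ℝ` determined by extended-real endpoints `a`, `b`. -/
def EI (a b : EReal) : Set ℝ := {x : ℝ | a < (x : EReal) ∧ (x : EReal) < b}

/-- The jump `Δ_{df}(x) = f⁺(x) - f⁻(x)` of a real-valued function. -/
def jump (f : ℝ → ℝ) (x : ℝ) : ℝ := rightLim f x - leftLim f x

/-- The jump `Δ_{df}(x) = f⁺(x) - f⁻(x)` of a complex-valued function. -/
def jumpC (f : ℝ → ℂ) (x : ℝ) : ℂ := rightLim f x - leftLim f x

/-- `θ_z(x) = 1 - z² Δ_{dα}(x) Δ_{dβ}(x)`. -/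
def theta (α β : ℝ → ℝ) (z x : ℝ) : ℝ := 1 - z ^ 2 * jump α x * jump β x

/-- `ω(x) = 1 - Δ_{dα}(x) Δ_{dβ}(x) / 4`. -/
def omegaFn (α β : ℝ → ℝ) (x : ℝ) : ℝ := 1 - jump α x * jump β x / 4

/-- A real-valued function is `r`-balanced on `I`: it is of locally bounded variation and
`f(x) = r f⁻(x) + (1-r) f⁺(x)` for all `x ∈ I`. -/
def RBalanced (r : ℝ) (I : Set ℝ) (f : ℝ → ℝ) : Prop :=
  LocallyBoundedVariationOn f I ∧
    ∀ x ∈ I, f x = r * leftLim f x + (1 - r) * rightLim f x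

/-- A complex-valued function is `r`-balanced on `I`. -/
def RBalancedC (r : ℂ) (I : Set ℝ) (f : ℝ → ℂ) : Prop :=
  LocallyBoundedVariationOn f I ∧
    ∀ x ∈ I, f x = r * leftLim f x + (1 - r) * rightLim f x

/-- `ν` coincides on `[c,d]` with the Lebesgue–Stieltjes measure `df` generated by `f`,
determined by `df((x,y]) = f⁺(y) - f⁺(x)`. -/
def SMRepresents (ν : SignedMeasure ℝ) (f : ℝ → ℝ) (c d : ℝ) : Prop :=
  ∀ x ∈ Icc c d, ∀ y ∈ Icc c d, x ≤ y → ν (Ioc x y) = rightLim f y - rightLim f x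

/-- The integral of `h` against the signed measure `ν` over the set `E`. -/
def sInt (ν : SignedMeasure ℝ) (h : ℝ → ℝ) (E : Set ℝ) : ℝ :=
  (∫ x in E, h x ∂ν.toJordanDecomposition.posPart) -
    (∫ x in E, h x ∂ν.toJordanDecomposition.negPart)

/-- The equality of (locally finite, real Borel) measures `dg = ∑ j, (h j) d(β j)` on the
interval `I`, expressed via localizations to compact subintervals of `I`. -/
def MeasureEqOn (I : Set ℝ) {ι : Type} [Fintype ι] (g : ℝ → ℝ) (h β : ι → ℝ → ℝ) : Prop :=
  ∀ c ∈ I, ∀ d ∈ I, c < d →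
    ∃ (νg : SignedMeasure ℝ) (ν : ι → SignedMeasure ℝ),
      SMRepresents νg g c d ∧ (∀ j, SMRepresents (ν j) (β j) c d) ∧
      ∀ E : Set ℝ, E ⊆ Ioc c d → MeasurableSet E → νg E = ∑ j, sInt (ν j) (h j) E

/-- The equality of complex measures `dg = ∑ j, (h j) d(β j)` on `I`, encoded via real and
imaginary parts. -/
def MeasureEqOnC (I : Set ℝ) {ι : Type} [Fintype ι] (g : ℝ → ℂ) (h β : ι → ℝ → ℂ) : Prop :=
  MeasureEqOn I (fun x => (g x).re)
    (Sum.elim (fun j x => (h j x).re) (fun j x => -(h j x).im))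
    (Sum.elim (fun j x => (β j x).re) (fun j x => (β j x).im)) ∧
  MeasureEqOn I (fun x => (g x).im)
    (Sum.elim (fun j x => (h j x).im) (fun j x => (h j x).re))
    (Sum.elim (fun j x => (β j x).re) (fun j x => (β j x).im))

/-- The support of `dα` is all of `I`: no open subinterval of `I` is `dα`-null, i.e. on no
open subinterval of `I` do all one-sided limits of `α` coincide with a single constant. -/
def SuppFull (I : Set ℝ) (α : ℝ → ℂ) : Prop :=
  ∀ x ∈ I, ∀ ε > (0 : ℝ), Icc (x - ε) (x + ε) ⊆ I →
    ¬ (∀ p ∈ Ioo (x - ε) (x + ε), ∀ q ∈ Ioo (x - ε) (x + ε),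
        rightLim α p = rightLim α q ∧ leftLim α p = rightLim α q)

/-- `u`, together with the representative `w` of `du/dα`, is an `r`-balanced solution of the
homogeneous equation `-d(du/dα) + u dβ = 0` on `I`: `u` and `w` are `r`-balanced,
`du = w dα` (so `du ≪ dα` with `du/dα = w`), and `dw = u dβ`. -/
def IsHomSol (I : Set ℝ) (r : ℝ) (α β u w : ℝ → ℝ) : Prop :=
  RBalanced r I u ∧ RBalanced r I w ∧
  MeasureEqOn I u (fun _ : Fin 1 => w) (fun _ => α) ∧
  MeasureEqOn I w (fun _ : Fin 1 => u) (fun _ => β)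

/-- `u`, together with the representative `w` of `du/dα`, is an `r`-balanced solution of
`-d(du/dα) + u dβ = dη` on `I` (complex-valued coefficients): `dw = u dβ - dη`. -/
def IsSolC (I : Set ℝ) (r : ℂ) (α β η u w : ℝ → ℂ) : Prop :=
  RBalancedC r I u ∧ RBalancedC r I w ∧
  MeasureEqOnC I u (fun _ : Fin 1 => w) (fun _ => α) ∧
  MeasureEqOnC I w ![u, fun _ => (-1 : ℂ)] ![β, η]

/-- `y` solves the linear system `dy = dφ · y + dψ` on `I`, componentwise:
`d(y i) = ∑ j, (y j) d(φ i j) + dψ i`. -/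
def IsSysSolC (I : Set ℝ) (n : ℕ) (φ : ℝ → Matrix (Fin n) (Fin n) ℂ)
    (ψ : ℝ → Fin n → ℂ) (y : ℝ → Fin n → ℂ) : Prop :=
  ∀ i : Fin n,
    MeasureEqOnC I (fun x => y x i)
      (Sum.elim (fun j : Fin n => fun x => y x j) (fun _ : Unit => fun _ => (1 : ℂ)))
      (Sum.elim (fun j : Fin n => fun x => φ x i j) (fun _ : Unit => fun x => ψ x i))

/-- `Z_I(f) = {x ∈ I : f⁻(x) f⁺(x) ≤ 0}`, the set of sign-changing points of `f` in `I`. -/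
def ZSet (f : ℝ → ℝ) (I : Set ℝ) : Set ℝ := {x ∈ I | leftLim f x * rightLim f x ≤ 0}

/-- `u` changes sign at `s ∈ I`. -/
def ChangesSignAt (I : Set ℝ) (u : ℝ → ℝ) (s : ℝ) : Prop :=
  ∃ δ > (0 : ℝ), Ioo (s - δ) (s + δ) ⊆ I ∧
    (((∀ x ∈ Ioo (s - δ) s, leftLim u x < 0) ∧ ∀ x ∈ Ioo s (s + δ), 0 < rightLim u x) ∨
     ((∀ x ∈ Ioo (s - δ) s, 0 < leftLim u x) ∧ ∀ x ∈ Ioo s (s + δ), rightLim u x < 0))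

/-- `u` changes sign in `J` (a subinterval of `I`). -/
def ChangesSignIn (I : Set ℝ) (u : ℝ → ℝ) (J : Set ℝ) : Prop :=
  ∃ s ∈ J, ChangesSignAt I u s

/-- `u` and `v` are linearly dependent on `I`. -/
def LinDepOn (I : Set ℝ) (u v : ℝ → ℝ) : Prop :=
  ∃ c₁ c₂ : ℝ, ¬(c₁ = 0 ∧ c₂ = 0) ∧ ∀ x ∈ I, c₁ * u x + c₂ * v x = 0

/-- The Lebesgue–Stieltjes measure `dg` is nonnegative on (Borel subsets of) `S`, expressed by
nonnegativity on all subintervals of `S` of each of the four kinds. -/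
def PosMeasureOn (g : ℝ → ℝ) (S : Set ℝ) : Prop :=
  (∀ x y : ℝ, x ≤ y → Icc x y ⊆ S → 0 ≤ rightLim g y - leftLim g x) ∧
  (∀ x y : ℝ, x ≤ y → Ico x y ⊆ S → 0 ≤ leftLim g y - leftLim g x) ∧
  (∀ x y : ℝ, x ≤ y → Ioc x y ⊆ S → 0 ≤ rightLim g y - rightLim g x) ∧
  (∀ x y : ℝ, x < y → Ioo x y ⊆ S → 0 ≤ leftLim g y - rightLim g x)

theorem LocallyBoundedVariationOn.tendsto_leftLim {f : ℝ → ℝ} {I : Set ℝ} {t : ℝ}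
    (hf : LocallyBoundedVariationOn f I) (hI : I ∈ 𝓝 t) :
    Tendsto f (𝓝[<] t) (𝓝 (leftLim f t)) := by
  obtain ⟨ε, hε, hball⟩ := Metric.nhds_basis_closedBall.mem_iff.1 hI
  rw [Real.closedBall_eq_Icc] at hball
  have hbv := hf (t - ε) (t + ε) (hball ⟨le_rfl, by linarith⟩) (hball ⟨by linarith, le_rfl⟩)
  obtain ⟨l, hl⟩ := hbv.exists_tendsto_left t
  refine tendsto_leftLim_of_tendsto ⟨l, hl.mono_left ?_⟩
  refine nhdsWithin_le_iff.2 ?_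
  filter_upwards [Ioo_mem_nhdsLT (show t - ε < t by linarith)] with p hp
  have h : p ∈ Icc (t - ε) (t + ε) := ⟨hp.1.le, by linarith [hp.2]⟩
  exact ⟨⟨hball h, h⟩, hp.2⟩

theorem LocallyBoundedVariationOn.tendsto_rightLim {f : ℝ → ℝ} {I : Set ℝ} {t : ℝ}
    (hf : LocallyBoundedVariationOn f I) (hI : I ∈ 𝓝 t) :
    Tendsto f (𝓝[>] t) (𝓝 (rightLim f t)) := by
  obtain ⟨ε, hε, hball⟩ := Metric.nhds_basis_closedBall.mem_iff.1 hI
  rw [Real.closedBall_eq_Icc] at hball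
  have hbv := hf (t - ε) (t + ε) (hball ⟨le_rfl, by linarith⟩) (hball ⟨by linarith, le_rfl⟩)
  obtain ⟨l, hl⟩ := hbv.exists_tendsto_right t
  refine tendsto_rightLim_of_tendsto ⟨l, hl.mono_left ?_⟩
  refine nhdsWithin_le_iff.2 ?_
  filter_upwards [Ioo_mem_nhdsGT (show t < t + ε by linarith)] with p hp
  have h : p ∈ Icc (t - ε) (t + ε) := ⟨by linarith [hp.1], hp.2.le⟩
  exact ⟨⟨hball h, h⟩, hp.1⟩

theorem tendsto_rightLim_nhdsGT {f : ℝ → ℝ} {t : ℝ}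
    (h : Tendsto f (𝓝[>] t) (𝓝 (rightLim f t))) :
    Tendsto (rightLim f) (𝓝[>] t) (𝓝 (rightLim f t)) :=
  (continuousWithinAt_rightLim_Ici h).tendsto.mono_left (nhdsWithin_mono _ Ioi_subset_Ici_self)

theorem tendsto_rightLim_nhdsLT {f : ℝ → ℝ} {t : ℝ}
    (h : Tendsto f (𝓝[<] t) (𝓝 (leftLim f t))) :
    Tendsto (rightLim f) (𝓝[<] t) (𝓝 (leftLim f t)) := by
  refine (closed_nhds_basis (leftLim f t)).tendsto_right_iff.2 fun s hs => ?_
  obtain ⟨u, hut, hu⟩ := (mem_nhdsLT_iff_exists_Ioo_subset).1 (h hs.1)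
  filter_upwards [Ioo_mem_nhdsLT hut] with c hc
  by_cases hex : ∃ y, Tendsto f (𝓝[>] c) (𝓝 y)
  · refine hs.2.mem_of_tendsto (tendsto_rightLim_of_tendsto hex) ?_
    filter_upwards [Ioo_mem_nhdsGT_of_mem ⟨hc.1.le, hc.2⟩] with p hp using hu hp
  · rw [rightLim_eq_of_not_tendsto _ hex]
    exact hu hc

theorem LocallyBoundedVariationOn.integrableOn_Icc {f : ℝ → ℝ} {I : Set ℝ} {c d : ℝ}
    (hf : LocallyBoundedVariationOn f I) (hI : Icc c d ⊆ I) (μ : Measure ℝ) [IsFiniteMeasure μ] :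
    IntegrableOn f (Icc c d) μ := by
  obtain ⟨p, q, hp, hq, rfl⟩ := hf.exists_monotoneOn_sub_monotoneOn
  exact ((hp.mono hI).integrableOn_isCompact isCompact_Icc).sub
    ((hq.mono hI).integrableOn_isCompact isCompact_Icc)

theorem tendsto_measureReal_Ioc_nhdsGT (μ : Measure ℝ) [IsFiniteMeasure μ] (s : ℝ) :
    Tendsto (fun t => μ.real (Ioc s t)) (𝓝[>] s) (𝓝 0) := by
  have h := tendsto_measure_biInter_gt (μ := μ) (s := fun t => Ioc s t) (a := s)
    (fun r _ => measurableSet_Ioc.nullMeasurableSet)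
    (fun i j _ hij => Ioc_subset_Ioc_right hij) ⟨s + 1, by simp, measure_ne_top _ _⟩
  have he : ⋂ r > s, Ioc s r = ∅ := by
    ext p
    simp only [mem_iInter, mem_Ioc, mem_empty_iff_false, iff_false, not_forall]
    by_cases hp : s < p
    · exact ⟨(s + p) / 2, by simp; linarith, fun h => by linarith [h.2]⟩
    · exact ⟨s + 1, by simp, fun h => hp h.1⟩
  rw [he, measure_empty] at h
  exact (ENNReal.tendsto_toReal ENNReal.zero_ne_top).comp h

theorem tendsto_measureReal_Ioo_nhdsLT (μ : Measure ℝ) [IsFiniteMeasure μ] (t : ℝ) :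
    Tendsto (fun s => μ.real (Ioo s t)) (𝓝[<] t) (𝓝 0) := by
  have h := tendsto_measure_biInter_gt (ι := ℝᵒᵈ) (μ := μ)
    (s := fun s => Ioo (OrderDual.ofDual s) t) (a := OrderDual.toDual t)
    (fun r _ => measurableSet_Ioo.nullMeasurableSet)
    (fun i j _ hij => Ioo_subset_Ioo_left hij)
    ⟨OrderDual.toDual (t - 1), OrderDual.toDual_lt_toDual.2 (by simp), measure_ne_top _ _⟩
  have he : ⋂ r > OrderDual.toDual t, Ioo (OrderDual.ofDual r) t = ∅ := by
    ext p
    simp only [mem_iInter, mem_Ioo, mem_empty_iff_false, iff_false, not_forall]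
    by_cases hp : p < t
    · exact ⟨OrderDual.toDual ((t + p) / 2), OrderDual.toDual_lt_toDual.2 (by linarith),
        fun h => by have := h.1; simp only [OrderDual.ofDual_toDual] at this; linarith⟩
    · exact ⟨OrderDual.toDual (t - 1), OrderDual.toDual_lt_toDual.2 (by simp), fun h => hp h.2⟩
  rw [he, measure_empty] at h
  exact (ENNReal.tendsto_toReal ENNReal.zero_ne_top).comp h

theorem tendsto_measureReal_Ioc_nhdsLT (μ : Measure ℝ) [IsFiniteMeasure μ] (t : ℝ) :
    Tendsto (fun s => μ.real (Ioc s t)) (𝓝[<] t) (𝓝 (μ.real {t})) := by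
  have h := (tendsto_measureReal_Ioo_nhdsLT μ t).add_const (μ.real {t})
  rw [zero_add] at h
  refine h.congr' ?_
  filter_upwards [self_mem_nhdsWithin] with s hs
  rw [← Ioo_union_right hs, measureReal_union (by simp) (measurableSet_singleton t)]

theorem SMRepresents.apply_singleton {ν : SignedMeasure ℝ} {f : ℝ → ℝ} {c d t : ℝ}
    (hν : SMRepresents ν f c d) (ht : t ∈ Ioc c d)
    (hf : Tendsto f (𝓝[<] t) (𝓝 (leftLim f t))) : ν {t} = jump f t := by
  have h1 : Tendsto (fun s => ν (Ioc s t)) (𝓝[<] t) (𝓝 (ν {t})) := by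
    simp only [ν.apply_eq_posPart_real_sub_negPart_real measurableSet_Ioc,
      ν.apply_eq_posPart_real_sub_negPart_real (measurableSet_singleton t)]
    exact (tendsto_measureReal_Ioc_nhdsLT _ t).sub (tendsto_measureReal_Ioc_nhdsLT _ t)
  refine tendsto_nhds_unique h1 (((tendsto_rightLim_nhdsLT hf).const_sub (rightLim f t)).congr' ?_)
  filter_upwards [Ioo_mem_nhdsLT ht.1] with s hs
  exact (hν s ⟨hs.1.le, hs.2.le.trans ht.2⟩ t ⟨ht.1.le, ht.2⟩ hs.2.le).symm

theorem abs_apply_le_totalVariation_real (ν : SignedMeasure ℝ) {E : Set ℝ}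
    (hE : MeasurableSet E) : |ν E| ≤ ν.totalVariation.real E := by
  rw [ν.apply_eq_posPart_real_sub_negPart_real hE, SignedMeasure.totalVariation,
    measureReal_add_apply]
  refine (abs_sub _ _).trans_eq ?_
  rw [abs_of_nonneg measureReal_nonneg, abs_of_nonneg measureReal_nonneg]

theorem sInt_singleton (ν : SignedMeasure ℝ) (h : ℝ → ℝ) (t : ℝ) :
    sInt ν h {t} = h t * ν {t} := by
  rw [sInt, ν.apply_eq_posPart_real_sub_negPart_real (measurableSet_singleton t)]
  simp [Measure.restrict_singleton, Measure.real]
  ring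

theorem abs_sInt_sub_le (ν : SignedMeasure ℝ) {h : ℝ → ℝ} {E : Set ℝ} (hE : MeasurableSet E)
    (hp : IntegrableOn h E ν.toJordanDecomposition.posPart)
    (hn : IntegrableOn h E ν.toJordanDecomposition.negPart) {k C : ℝ}
    (hC : ∀ p ∈ E, |h p - k| ≤ C) :
    |sInt ν h E - k * ν E| ≤ C * ν.totalVariation.real E := by
  have key : ∀ ρ : Measure ℝ, IsFiniteMeasure ρ → IntegrableOn h E ρ →
      |(∫ x in E, h x ∂ρ) - k * ρ.real E| ≤ C * ρ.real E := by
    intro ρ _ hi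
    have h1 : (∫ x in E, h x ∂ρ) - k * ρ.real E = ∫ x in E, (h x - k) ∂ρ := by
      rw [integral_sub hi (integrable_const k), setIntegral_const, smul_eq_mul, mul_comm]
    rw [h1]
    exact norm_setIntegral_le_of_norm_le_const (f := fun x => h x - k) (measure_lt_top ρ E) hC
  have h1 := key _ inferInstance hp
  have h2 := key _ inferInstance hn
  rw [ν.apply_eq_posPart_real_sub_negPart_real hE, SignedMeasure.totalVariation,
    measureReal_add_apply, sInt]
  rw [abs_le] at *
  constructor <;> linarith [h1.1, h1.2, h2.1, h2.2]

/-- Local consequences of `dg = h dβ` on `(c,d]`, with a finite measure `μ` dominating `|dβ|`. -/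
structure DensityOn (μ : Measure ℝ) (g h β : ℝ → ℝ) (c d : ℝ) : Prop where
  abs_sub_le : ∀ s ∈ Icc c d, ∀ t ∈ Icc c d, s ≤ t → ∀ k C : ℝ, 0 ≤ C →
    (∀ p ∈ Ioc s t, |h p - k| ≤ C) →
      |rightLim g t - rightLim g s - k * (rightLim β t - rightLim β s)| ≤ C * μ.real (Ioc s t)
  abs_integrator_le : ∀ s ∈ Icc c d, ∀ t ∈ Icc c d, s ≤ t →
    |rightLim β t - rightLim β s| ≤ μ.real (Ioc s t)
  jump_eq : ∀ t ∈ Ioc c d, jump g t = h t * jump β t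
  abs_jump_le : ∀ t ∈ Ioc c d, |jump β t| ≤ μ.real {t}

theorem DensityOn.mono {μ μ' : Measure ℝ} {g h β : ℝ → ℝ} {c d : ℝ}
    (H : DensityOn μ g h β c d) (hle : ∀ E, μ.real E ≤ μ'.real E) : DensityOn μ' g h β c d where
  abs_sub_le s hs t ht hst k C hC hk :=
    (H.abs_sub_le s hs t ht hst k C hC hk).trans (mul_le_mul_of_nonneg_left (hle _) hC)
  abs_integrator_le s hs t ht hst := (H.abs_integrator_le s hs t ht hst).trans (hle _)
  jump_eq := H.jump_eq
  abs_jump_le t ht := (H.abs_jump_le t ht).trans (hle _)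

theorem MeasureEqOn.exists_densityOn {I : Set ℝ} {g h β : ℝ → ℝ} {c d : ℝ}
    (H : MeasureEqOn I g (fun _ : Fin 1 => h) (fun _ => β)) (hc : c ∈ I) (hd : d ∈ I) (hcd : c < d)
    (hI : ∀ t ∈ Icc c d, I ∈ 𝓝 t) (hg : LocallyBoundedVariationOn g I)
    (hh : LocallyBoundedVariationOn h I) (hβ : LocallyBoundedVariationOn β I) :
    ∃ μ : Measure ℝ, IsFiniteMeasure μ ∧ DensityOn μ g h β c d := by
  obtain ⟨νg, ν, hνg, hν, heq⟩ := H c hc d hd hcd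
  have hsub : Icc c d ⊆ I := fun t ht => mem_of_mem_nhds (hI t ht)
  have happly : ∀ E : Set ℝ, E ⊆ Ioc c d → MeasurableSet E → νg E = sInt (ν 0) h E := by
    intro E hE hm
    rw [heq E hE hm, Fin.sum_univ_one]
  refine ⟨(ν 0).totalVariation, by unfold SignedMeasure.totalVariation; infer_instance,
    fun s hs t ht hst k C _ hk => ?_, fun s hs t ht hst => ?_, fun t ht => ?_, fun t ht => ?_⟩
  · have hst' : Ioc s t ⊆ Ioc c d := Ioc_subset_Ioc hs.1 ht.2
    rw [← hνg s hs t ht hst, ← hν 0 s hs t ht hst, happly _ hst' measurableSet_Ioc]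
    exact abs_sInt_sub_le _ measurableSet_Ioc
      ((hh.integrableOn_Icc hsub _).mono_set (hst'.trans Ioc_subset_Icc_self))
      ((hh.integrableOn_Icc hsub _).mono_set (hst'.trans Ioc_subset_Icc_self)) hk
  · rw [← hν 0 s hs t ht hst]
    exact abs_apply_le_totalVariation_real _ measurableSet_Ioc
  · have hIt := hI t (Ioc_subset_Icc_self ht)
    rw [← hνg.apply_singleton ht (hg.tendsto_leftLim hIt),
      ← (hν 0).apply_singleton ht (hβ.tendsto_leftLim hIt),
      happly _ (singleton_subset_iff.2 ht) (measurableSet_singleton t), sInt_singleton]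
  · rw [← (hν 0).apply_singleton ht (hβ.tendsto_leftLim (hI t (Ioc_subset_Icc_self ht)))]
    exact abs_apply_le_totalVariation_real _ (measurableSet_singleton t)

theorem DensityOn.isLittleO {μ : Measure ℝ} {g h β : ℝ → ℝ} {c d s : ℝ}
    (H : DensityOn μ g h β c d) (hs : s ∈ Ico c d)
    (hh : Tendsto h (𝓝[>] s) (𝓝 (rightLim h s))) :
    (fun t => rightLim g t - rightLim g s - rightLim h s * (rightLim β t - rightLim β s))
      =o[𝓝[>] s] fun t => μ.real (Ioc s t) := by
  refine Asymptotics.isLittleO_iff.2 fun ε hε => ?_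
  obtain ⟨u, hsu, hu⟩ := mem_nhdsGT_iff_exists_Ioo_subset.1
    (hh (Metric.closedBall_mem_nhds (rightLim h s) hε))
  filter_upwards [Ioo_mem_nhdsGT hs.2, Ioo_mem_nhdsGT hsu] with t ht htu
  rw [Real.norm_eq_abs, Real.norm_eq_abs, abs_of_nonneg (measureReal_nonneg (μ := μ))]
  exact H.abs_sub_le s (Ico_subset_Icc_self hs) t ⟨hs.1.trans ht.1.le, ht.2.le⟩ ht.1.le _ _ hε.le
    fun p hp => hu ⟨hp.1, hp.2.trans_lt htu.2⟩

theorem DensityOn.isBigO_integrator {μ : Measure ℝ} {g h β : ℝ → ℝ} {c d s : ℝ}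
    (H : DensityOn μ g h β c d) (hs : s ∈ Ico c d) :
    (fun t => rightLim β t - rightLim β s) =O[𝓝[>] s] fun t => μ.real (Ioc s t) := by
  refine Asymptotics.IsBigO.of_bound 1 ?_
  filter_upwards [Ioo_mem_nhdsGT hs.2] with t ht
  rw [Real.norm_eq_abs, Real.norm_eq_abs, abs_of_nonneg (measureReal_nonneg (μ := μ)), one_mul]
  exact H.abs_integrator_le s (Ico_subset_Icc_self hs) t ⟨hs.1.trans ht.1.le, ht.2.le⟩ ht.1.le

theorem DensityOn.isBigO {μ : Measure ℝ} {g h β : ℝ → ℝ} {c d s : ℝ}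
    (H : DensityOn μ g h β c d) (hs : s ∈ Ico c d)
    (hh : Tendsto h (𝓝[>] s) (𝓝 (rightLim h s))) :
    (fun t => rightLim g t - rightLim g s) =O[𝓝[>] s] fun t => μ.real (Ioc s t) :=
  ((H.isLittleO hs hh).isBigO.add ((H.isBigO_integrator hs).const_mul_left (rightLim h s))).congr_left
    fun t => by ring

/-- The right-continuous Wronskian has vanishing right derivative with respect to `μ`. -/
theorem isLittleO_wronskian_increment {μ : Measure ℝ} [IsFiniteMeasure μ]
    {α β u wu v wv : ℝ → ℝ} {c d s : ℝ} (hs : s ∈ Ico c d)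
    (Hu : DensityOn μ u wu α c d) (Hwu : DensityOn μ wu u β c d)
    (Hv : DensityOn μ v wv α c d) (Hwv : DensityOn μ wv v β c d)
    (hu : Tendsto u (𝓝[>] s) (𝓝 (rightLim u s)))
    (hwu : Tendsto wu (𝓝[>] s) (𝓝 (rightLim wu s)))
    (hv : Tendsto v (𝓝[>] s) (𝓝 (rightLim v s)))
    (hwv : Tendsto wv (𝓝[>] s) (𝓝 (rightLim wv s))) :
    (fun t => (rightLim u t * rightLim wv t - rightLim v t * rightLim wu t) -
        (rightLim u s * rightLim wv s - rightLim v s * rightLim wu s))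
      =o[𝓝[>] s] fun t => μ.real (Ioc s t) := by
  have hm : (fun t => μ.real (Ioc s t)) =o[𝓝[>] s] fun _ => (1 : ℝ) :=
    (Asymptotics.isLittleO_one_iff ℝ).2 (tendsto_measureReal_Ioc_nhdsGT μ s)
  have e1 := ((Hu.isBigO hs hwu).trans_isLittleO hm).mul_isBigO (Hwv.isBigO hs hv)
  have e2 := ((Hv.isBigO hs hwv).trans_isLittleO hm).mul_isBigO (Hwu.isBigO hs hu)
  simp only [one_mul] at e1 e2
  refine ((((((Hwv.isLittleO hs hv).const_mul_left (rightLim u s)).sub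
    ((Hwu.isLittleO hs hu).const_mul_left (rightLim v s))).add
    ((Hu.isLittleO hs hwu).const_mul_left (rightLim wv s))).sub
    ((Hv.isLittleO hs hwv).const_mul_left (rightLim wu s))).add (e1.sub e2)).congr_left ?_
  intro t
  ring

theorem eq_of_isLittleO_measureReal_Ioc {μ : Measure ℝ} [IsFiniteMeasure μ] {Q : ℝ → ℝ} {x y : ℝ}
    (hxy : x ≤ y) (hleft : ∀ t ∈ Ioc x y, Tendsto Q (𝓝[<] t) (𝓝 (Q t)))
    (hright : ∀ s ∈ Ico x y, (fun t => Q t - Q s) =o[𝓝[>] s] fun t => μ.real (Ioc s t)) :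
    Q y = Q x := by
  have key : ∀ ε > 0, |Q y - Q x| ≤ ε * μ.real (Ioc x y) := by
    intro ε hε
    let S : Set ℝ := {t | t ∈ Icc x y ∧ ∀ p ∈ Icc x t, |Q p - Q x| ≤ ε * μ.real (Ioc x p)}
    have hxS : x ∈ S := by
      refine ⟨left_mem_Icc.2 hxy, fun p hp => ?_⟩
      obtain rfl : p = x := le_antisymm hp.2 hp.1
      simp
    have hbdd : BddAbove S := ⟨y, fun t ht => ht.1.2⟩
    have hσx : x ≤ sSup S := le_csSup hbdd hxS
    have hσy : sSup S ≤ y := csSup_le ⟨x, hxS⟩ fun t ht => ht.1.2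
    have hlt : ∀ p, x ≤ p → p < sSup S → |Q p - Q x| ≤ ε * μ.real (Ioc x p) := by
      intro p hp hpσ
      obtain ⟨t, ht, hpt⟩ := exists_lt_of_lt_csSup ⟨x, hxS⟩ hpσ
      exact ht.2 p ⟨hp, hpt.le⟩
    have hσ : |Q (sSup S) - Q x| ≤ ε * μ.real (Ioc x (sSup S)) := by
      rcases hσx.eq_or_lt with h | h
      · rw [← h]; simp
      · refine le_of_tendsto (((hleft _ ⟨h, hσy⟩).sub_const (Q x)).abs) ?_
        filter_upwards [Ioo_mem_nhdsLT h] with p hp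
        exact (hlt p hp.1.le hp.2).trans (mul_le_mul_of_nonneg_left
          (measureReal_mono (Ioc_subset_Ioc_right hp.2.le)) hε.le)
    have hσS : ∀ p ∈ Icc x (sSup S), |Q p - Q x| ≤ ε * μ.real (Ioc x p) := by
      intro p hp
      rcases hp.2.eq_or_lt with h | h
      · rw [h]; exact hσ
      · exact hlt p hp.1 h
    rcases hσy.eq_or_lt with h | h
    · rw [h] at hσ; exact hσ
    · exfalso
      obtain ⟨w, hw, hsub⟩ := mem_nhdsGT_iff_exists_Ioo_subset.1
        (Asymptotics.isLittleO_iff.1 (hright _ ⟨hσx, h⟩) hε)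
      obtain ⟨τ, hτ1, hτ2⟩ := exists_between (lt_min hw h)
      have hτS : τ ∈ S := by
        refine ⟨⟨hσx.trans hτ1.le, (hτ2.le.trans (min_le_right _ _))⟩, fun p hp => ?_⟩
        rcases le_or_gt p (sSup S) with hpσ | hpσ
        · exact hσS p ⟨hp.1, hpσ⟩
        · have h1 := hsub ⟨hpσ, (hp.2.trans_lt hτ2).trans_le (min_le_left _ _)⟩
          simp only [mem_ofPred_eq, Real.norm_eq_abs,
            abs_of_nonneg (measureReal_nonneg (μ := μ))] at h1
          have h2 : μ.real (Ioc x p) = μ.real (Ioc x (sSup S)) + μ.real (Ioc (sSup S) p) := by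
            rw [← Ioc_union_Ioc_eq_Ioc hσx hpσ.le, measureReal_union
              (Ioc_disjoint_Ioc_of_le le_rfl) measurableSet_Ioc]
          rw [h2, mul_add]
          exact (abs_sub_le _ (Q (sSup S)) _).trans (by linarith)
      exact absurd (le_csSup hbdd hτS) (not_le.2 hτ1)
  have h0 : |Q y - Q x| ≤ 0 := by
    have hT : Tendsto (fun ε : ℝ => ε * μ.real (Ioc x y)) (𝓝[>] 0) (𝓝 (0 * μ.real (Ioc x y))) :=
      (tendsto_id.mono_left nhdsWithin_le_nhds).mul_const _
    rw [zero_mul] at hT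
    exact ge_of_tendsto hT (by filter_upwards [self_mem_nhdsWithin] with ε hε using key ε hε)
  exact sub_eq_zero.1 (abs_nonpos_iff.1 h0)

theorem sum_indicator_measureReal_singleton_le (μ : Measure ℝ) [IsFiniteMeasure μ] (E : Set ℝ)
    (T : Finset ℝ) : ∑ p ∈ T, E.indicator (fun p => μ.real {p}) p ≤ μ.real E := by
  classical
  rw [← Finset.sum_filter_add_sum_filter_not T (· ∈ E),
    Finset.sum_congr rfl fun p hp => indicator_of_mem (Finset.mem_filter.1 hp).2 _,
    Finset.sum_congr (s₁ := T.filter (· ∉ E)) rfl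
      fun p hp => indicator_of_notMem (Finset.mem_filter.1 hp).2 _,
    Finset.sum_const_zero, add_zero, sum_measureReal_singleton]
  exact measureReal_mono fun p hp => (Finset.mem_filter.1 hp).2

/-- Factors deviating from `1` by at most twice the squared point mass, wherever that mass is
small. -/
def NearOneOn (μ : Measure ℝ) (φ : ℝ → ℝ) (E : Set ℝ) : Prop :=
  ∀ p ∈ E, μ.real {p} ≤ 1 / 2 → |φ p - 1| ≤ 2 * μ.real {p} ^ 2

theorem NearOneOn.multipliable {μ : Measure ℝ} [IsFiniteMeasure μ] {φ : ℝ → ℝ} {E : Set ℝ}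
    (H : NearOneOn μ φ E) : Multipliable (E.mulIndicator φ) := by
  have hs : Summable fun p => E.indicator (fun p => μ.real {p}) p :=
    summable_of_sum_le (fun p => indicator_nonneg (fun _ _ => measureReal_nonneg) p)
      (sum_indicator_measureReal_singleton_le μ E)
  have hev : ∀ᶠ p in cofinite, E.indicator (fun p => μ.real {p}) p ≤ 1 / 2 :=
    (hs.tendsto_cofinite_zero.eventually (eventually_le_nhds (by norm_num)))
  have hsum : Summable fun p => ‖E.mulIndicator φ p - 1‖ := by
    refine Summable.of_norm_bounded_eventually (hs.mul_left 1) ?_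
    filter_upwards [hev] with p hp
    by_cases hpE : p ∈ E
    · rw [indicator_of_mem hpE] at hp ⊢
      rw [mulIndicator_of_mem hpE, norm_norm, Real.norm_eq_abs]
      have h0 : 0 ≤ μ.real {p} := measureReal_nonneg
      exact (H p hpE hp).trans (by nlinarith)
    · simp [hpE]
  simpa using multipliable_one_add_of_summable hsum

theorem NearOneOn.abs_tprod_sub_one_le {μ : Measure ℝ} [IsFiniteMeasure μ] {φ : ℝ → ℝ} {E : Set ℝ}
    (H : NearOneOn μ φ E) (hE : μ.real E ≤ 1 / 2) :
    |∏' p, E.mulIndicator φ p - 1| ≤ 4 * μ.real E ^ 2 := by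
  have hlim := (H.multipliable.hasProd.sub_const 1).abs
  refine le_of_tendsto hlim (Eventually.of_forall fun T => ?_)
  have hE0 : 0 ≤ μ.real E := measureReal_nonneg
  have h1 := T.norm_prod_one_add_sub_one_le fun p => E.mulIndicator φ p - 1
  have h2 : ∑ p ∈ T, ‖E.mulIndicator φ p - 1‖ ≤ 2 * μ.real E ^ 2 := by
    calc ∑ p ∈ T, ‖E.mulIndicator φ p - 1‖
        ≤ ∑ p ∈ T, 2 * μ.real E * E.indicator (fun p => μ.real {p}) p := by
          refine Finset.sum_le_sum fun p _ => ?_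
          by_cases hpE : p ∈ E
          · rw [mulIndicator_of_mem hpE, indicator_of_mem hpE, Real.norm_eq_abs]
            have h3 : μ.real {p} ≤ μ.real E := measureReal_mono (singleton_subset_iff.2 hpE)
            have h0 : 0 ≤ μ.real {p} := measureReal_nonneg
            exact (H p hpE (h3.trans hE)).trans (by nlinarith)
          · simp [hpE]
      _ ≤ 2 * μ.real E * μ.real E := by
          rw [← Finset.mul_sum]
          exact mul_le_mul_of_nonneg_left (sum_indicator_measureReal_singleton_le μ E T)
            (by positivity)
      _ = 2 * μ.real E ^ 2 := by ring
  have h4 : 2 * μ.real E ^ 2 ≤ 1 := by nlinarith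
  have h5 := (abs_le.1 (Real.abs_exp_sub_one_le
    (abs_le.2 ⟨by nlinarith, h4⟩ : |2 * μ.real E ^ 2| ≤ 1))).2
  rw [abs_of_nonneg (by positivity : (0 : ℝ) ≤ 2 * μ.real E ^ 2)] at h5
  simp only [add_sub_cancel, Real.norm_eq_abs] at h1
  have h6 := Real.exp_le_exp.2 h2
  simp only [Real.norm_eq_abs] at h6
  exact h1.trans (by linarith)

theorem NearOneOn.mono {μ : Measure ℝ} {φ : ℝ → ℝ} {E F : Set ℝ}
    (H : NearOneOn μ φ F) (h : E ⊆ F) : NearOneOn μ φ E := fun p hp => H p (h hp)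

theorem NearOneOn.tprod_union {μ : Measure ℝ} [IsFiniteMeasure μ] {φ : ℝ → ℝ} {E F : Set ℝ}
    (H : NearOneOn μ φ (E ∪ F)) (hd : Disjoint E F) :
    ∏' p, (E ∪ F).mulIndicator φ p = (∏' p, E.mulIndicator φ p) * ∏' p, F.mulIndicator φ p := by
  rw [mulIndicator_union_of_disjoint hd]
  exact (H.mono subset_union_left).multipliable.tprod_mul (H.mono subset_union_right).multipliable

theorem NearOneOn.tprod_Ioc_mul {μ : Measure ℝ} [IsFiniteMeasure μ] {φ : ℝ → ℝ} {x s t : ℝ}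
    (H : NearOneOn μ φ (Ioc x t)) (hxs : x ≤ s) (hst : s ≤ t) :
    ∏' p, (Ioc x t).mulIndicator φ p =
      (∏' p, (Ioc x s).mulIndicator φ p) * ∏' p, (Ioc s t).mulIndicator φ p := by
  rw [← Ioc_union_Ioc_eq_Ioc hxs hst] at H ⊢
  exact H.tprod_union (Ioc_disjoint_Ioc_of_le le_rfl)

theorem tprod_mulIndicator_singleton (φ : ℝ → ℝ) (t : ℝ) :
    ∏' p, ({t} : Set ℝ).mulIndicator φ p = φ t := by
  rw [tprod_eq_mulSingle t fun p hp => mulIndicator_of_notMem (by simpa using hp) _]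
  simp

theorem NearOneOn.isLittleO_tprod {μ : Measure ℝ} [IsFiniteMeasure μ] {φ : ℝ → ℝ} {x y s : ℝ}
    (H : NearOneOn μ φ (Ioc x y)) (hs : s ∈ Ico x y) :
    (fun t => ∏' p, (Ioc s t).mulIndicator φ p - 1) =o[𝓝[>] s] fun t => μ.real (Ioc s t) := by
  have hm := tendsto_measureReal_Ioc_nhdsGT μ s
  have hm' : (fun t => μ.real (Ioc s t)) =o[𝓝[>] s] fun _ => (1 : ℝ) :=
    (Asymptotics.isLittleO_one_iff ℝ).2 hm
  have h2 : (fun t => μ.real (Ioc s t) ^ 2) =o[𝓝[>] s] fun t => μ.real (Ioc s t) :=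
    (hm'.mul_isBigO (Asymptotics.isBigO_refl (fun t => μ.real (Ioc s t)) _)).congr
      (fun _ => (sq _).symm) fun _ => one_mul _
  refine (Asymptotics.IsBigO.of_bound 4 ?_).trans_isLittleO h2
  filter_upwards [hm.eventually (eventually_le_nhds (by norm_num : (0 : ℝ) < 1 / 2)),
    Ioo_mem_nhdsGT hs.2] with t ht hty
  rw [Real.norm_eq_abs, Real.norm_eq_abs, abs_of_nonneg (sq_nonneg (μ.real (Ioc s t)))]
  exact (H.mono (Ioc_subset_Ioc hs.1 hty.2.le)).abs_tprod_sub_one_le ht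

theorem NearOneOn.tendsto_tprod_nhdsLT {μ : Measure ℝ} [IsFiniteMeasure μ] {φ : ℝ → ℝ} {x y t : ℝ}
    (H : NearOneOn μ φ (Ioc x y)) (ht : t ∈ Ioc x y) :
    Tendsto (fun s => ∏' p, (Ioc s t).mulIndicator φ p) (𝓝[<] t) (𝓝 (φ t)) := by
  have hm := tendsto_measureReal_Ioo_nhdsLT μ t
  have h1 : Tendsto (fun s => ∏' p, (Ioo s t).mulIndicator φ p - 1) (𝓝[<] t) (𝓝 0) := by
    refine squeeze_zero_norm' (a := fun s => 4 * μ.real (Ioo s t) ^ 2) ?_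
      (by simpa using (hm.pow 2).const_mul 4)
    filter_upwards [hm.eventually (eventually_le_nhds (by norm_num : (0 : ℝ) < 1 / 2)),
      Ioo_mem_nhdsLT ht.1] with s hs hsx
    exact (H.mono fun p hp => ⟨hsx.1.trans hp.1, hp.2.le.trans ht.2⟩).abs_tprod_sub_one_le hs
  have h2 := (h1.add_const 1).mul_const (φ t)
  simp only [sub_add_cancel, zero_add, one_mul] at h2
  refine h2.congr' ?_
  filter_upwards [Ioo_mem_nhdsLT ht.1] with s hs
  have hu := Ioo_union_right hs.2
  rw [← hu, NearOneOn.tprod_union (μ := μ), tprod_mulIndicator_singleton]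
  · rw [hu]
    exact H.mono (Ioc_subset_Ioc hs.1.le ht.2)
  · simp

/-- If `R` jumps by the factor `(φ t)⁻¹` at each `t` and has vanishing right derivative with
respect to `μ`, then `R y * ∏_{(x,y]} φ = R x`. -/
theorem NearOneOn.mul_tprod_eq {μ : Measure ℝ} [IsFiniteMeasure μ] {φ R L : ℝ → ℝ} {x y : ℝ}
    (H : NearOneOn μ φ (Ioc x y)) (hxy : x ≤ y) (hφ : ∀ t ∈ Ioc x y, φ t ≠ 0)
    (hL : ∀ t ∈ Ioc x y, Tendsto R (𝓝[<] t) (𝓝 (L t)))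
    (hRL : ∀ t ∈ Ioc x y, L t = R t * φ t)
    (hR : ∀ s ∈ Ico x y, (fun t => R t - R s) =o[𝓝[>] s] fun t => μ.real (Ioc s t)) :
    R y * ∏' p, (Ioc x y).mulIndicator φ p = R x := by
  have h := eq_of_isLittleO_measureReal_Ioc (μ := μ) (x := x) (y := y)
    (Q := fun t => R t * ∏' p, (Ioc x t).mulIndicator φ p) hxy ?_ ?_
  · simpa using h
  · intro t ht
    have hT := (hL t ht).mul (((H.tendsto_tprod_nhdsLT ht).inv₀ (hφ t ht)).const_mul
      (∏' p, (Ioc x t).mulIndicator φ p))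
    have hval : L t * ((∏' p, (Ioc x t).mulIndicator φ p) * (φ t)⁻¹) =
        R t * ∏' p, (Ioc x t).mulIndicator φ p := by
      rw [hRL t ht]
      field_simp [hφ t ht]
    rw [hval] at hT
    refine hT.congr' ?_
    filter_upwards [Ioo_mem_nhdsLT ht.1,
      (H.tendsto_tprod_nhdsLT ht).eventually_ne (hφ t ht)] with s hs hne
    rw [(H.mono (Ioc_subset_Ioc_right ht.2)).tprod_Ioc_mul hs.1.le hs.2.le, mul_assoc _ _ (_⁻¹),
      mul_inv_cancel₀ hne, mul_one]
  · intro s hs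
    have h1 := H.isLittleO_tprod hs
    have hone : Tendsto (fun t => ∏' p, (Ioc s t).mulIndicator φ p) (𝓝[>] s) (𝓝 1) := by
      have := (h1.trans_tendsto (tendsto_measureReal_Ioc_nhdsGT μ s)).add_const 1
      simpa using this
    have h2 := ((hR s hs).mul_isBigO (hone.isBigO_one ℝ)).congr_right (fun _ => mul_one _)
    refine ((h2.add (h1.const_mul_left (R s))).const_mul_left
      (∏' p, (Ioc x s).mulIndicator φ p)).congr' ?_ EventuallyEq.rfl
    filter_upwards [Ioo_mem_nhdsGT hs.2] with t ht
    rw [(H.mono (Ioc_subset_Ioc_right ht.2.le)).tprod_Ioc_mul hs.1 ht.1.le]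
    ring

theorem isOpen_EI (a b : EReal) : IsOpen (EI a b) :=
  isOpen_Ioo.preimage continuous_coe_real_ereal

theorem nearOneOn_theta_div {μ : Measure ℝ} {α β : ℝ → ℝ} {z z' : ℝ} (hz : z ∈ Icc (0 : ℝ) 1)
    (hz' : z + z' = 1) {E : Set ℝ} (hα : ∀ p ∈ E, |jump α p| ≤ μ.real {p})
    (hβ : ∀ p ∈ E, |jump β p| ≤ μ.real {p}) :
    NearOneOn μ (fun p => theta α β z p / theta α β z' p) E := by
  intro p hp hm
  obtain rfl : z' = 1 - z := by linarith
  have hm0 : 0 ≤ μ.real {p} := measureReal_nonneg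
  have hq : |jump α p * jump β p| ≤ μ.real {p} ^ 2 := by
    rw [abs_mul, sq]
    exact mul_le_mul (hα p hp) (hβ p hp) (abs_nonneg _) hm0
  simp only [theta, mul_assoc]
  generalize jump α p * jump β p = q at *
  generalize μ.real {p} = m at *
  obtain ⟨h0, h1⟩ := hz
  have hq4 : |q| ≤ 1 / 4 := hq.trans (by nlinarith)
  have hden : 1 / 2 ≤ 1 - (1 - z) ^ 2 * q := by
    have h2 : (1 - z) ^ 2 ≤ 1 := by nlinarith
    have h3 : (1 - z) ^ 2 * q ≤ 1 * |q| :=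
      (mul_le_mul_of_nonneg_left (le_abs_self q) (sq_nonneg _)).trans
        (mul_le_mul_of_nonneg_right h2 (abs_nonneg q))
    linarith
  have hpos : 0 < 1 - (1 - z) ^ 2 * q := by linarith
  have heq : (1 - z ^ 2 * q) / (1 - (1 - z) ^ 2 * q) - 1 =
      (1 - 2 * z) * q / (1 - (1 - z) ^ 2 * q) := by
    rw [eq_div_iff hpos.ne', sub_mul, div_mul_cancel₀ _ hpos.ne']
    ring
  rw [heq, abs_div, abs_of_pos hpos, div_le_iff₀ hpos, abs_mul]
  have h4 : |1 - 2 * z| ≤ 1 := abs_le.2 ⟨by linarith, by linarith⟩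
  have h5 : |1 - 2 * z| * |q| ≤ 1 * m ^ 2 := mul_le_mul h4 hq (abs_nonneg q) zero_le_one
  nlinarith [sq_nonneg m]

theorem RBalanced.eq_add_mul_jump {r : ℝ} {I : Set ℝ} {f : ℝ → ℝ} (hf : RBalanced r I f) {t : ℝ}
    (ht : t ∈ I) :
    rightLim f t = f t + r * jump f t ∧ leftLim f t = f t - (1 - r) * jump f t := by
  have h := hf.2 t ht
  unfold jump
  constructor <;> linarith

/-- the formula `W⁻[u,v](y) = W⁻[u,v](x) ∏_{t ∈ [x,y)} θ(t)` for the
left-continuous representative of the Wronskian of two `r`-balanced solutions. -/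
theorem statement16 (a b : EReal) (hab : a < b) (r : ℝ) (hr : r ∈ Icc (0 : ℝ) 1)
    (α β : ℝ → ℝ) (hα : StrictMonoOn α (EI a b))
    (hβ : LocallyBoundedVariationOn β (EI a b))
    (hθ : ∀ x ∈ EI a b, theta α β (1 - r) x ≠ 0 ∧ theta α β r x ≠ 0)
    (u wu v wv : ℝ → ℝ)
    (hu : IsHomSol (EI a b) r α β u wu) (hv : IsHomSol (EI a b) r α β v wv) :
    ∀ x ∈ EI a b, ∀ y ∈ EI a b, x < y →
      leftLim (fun z => u z * wv z - v z * wu z) y =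
        leftLim (fun z => u z * wv z - v z * wu z) x *
          ∏' t : (Ico x y : Set ℝ),
            (theta α β r (t : ℝ) / theta α β (1 - r) (t : ℝ)) := by
  intro x hx y hy hxy
  have hopen : ∀ t ∈ EI a b, EI a b ∈ 𝓝 t := fun t ht => (isOpen_EI a b).mem_nhds ht
  have hαbv : LocallyBoundedVariationOn α (EI a b) := hα.monotoneOn.locallyBoundedVariationOn
  obtain ⟨c, hcx, hcsub⟩ := mem_nhdsLT_iff_exists_Ico_subset.1
    (mem_nhdsWithin_of_mem_nhds (a := x) (hopen x hx))
  have hc : c ∈ EI a b := hcsub ⟨le_rfl, hcx⟩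
  replace hcx : c < x := hcx
  have hcy : c < y := hcx.trans hxy
  have hsub : Icc c y ⊆ EI a b := fun t ht =>
    ⟨hc.1.trans_le (EReal.coe_le_coe_iff.2 ht.1), (EReal.coe_le_coe_iff.2 ht.2).trans_lt hy.2⟩
  have hnhds : ∀ t ∈ Icc c y, EI a b ∈ 𝓝 t := fun t ht => hopen t (hsub ht)
  obtain ⟨hub, hwub, huα, hwuβ⟩ := hu
  obtain ⟨hvb, hwvb, hvα, hwvβ⟩ := hv
  obtain ⟨μ₁, _, H₁⟩ := huα.exists_densityOn hc hy hcy hnhds hub.1 hwub.1 hαbv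
  obtain ⟨μ₂, _, H₂⟩ := hwuβ.exists_densityOn hc hy hcy hnhds hwub.1 hub.1 hβ
  obtain ⟨μ₃, _, H₃⟩ := hvα.exists_densityOn hc hy hcy hnhds hvb.1 hwvb.1 hαbv
  obtain ⟨μ₄, _, H₄⟩ := hwvβ.exists_densityOn hc hy hcy hnhds hwvb.1 hvb.1 hβ
  obtain ⟨μ, hμ⟩ : ∃ μ, μ = μ₁ + μ₂ + μ₃ + μ₄ := ⟨_, rfl⟩
  have hfin : IsFiniteMeasure μ := by rw [hμ]; infer_instance
  have hreal : ∀ E, μ.real E = μ₁.real E + μ₂.real E + μ₃.real E + μ₄.real E := by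
    intro E
    rw [hμ, measureReal_add_apply, measureReal_add_apply, measureReal_add_apply]
  have hpos : ∀ E, 0 ≤ μ₁.real E ∧ 0 ≤ μ₂.real E ∧ 0 ≤ μ₃.real E ∧ 0 ≤ μ₄.real E := fun E =>
    ⟨measureReal_nonneg, measureReal_nonneg, measureReal_nonneg, measureReal_nonneg⟩
  replace H₁ : DensityOn μ u wu α c y := H₁.mono fun E => by grind
  replace H₂ : DensityOn μ wu u β c y := H₂.mono fun E => by grind
  replace H₃ : DensityOn μ v wv α c y := H₃.mono fun E => by grind
  replace H₄ : DensityOn μ wv v β c y := H₄.mono fun E => by grind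
  have hr' : 1 - r ∈ Icc (0 : ℝ) 1 := ⟨by linarith [hr.2], by linarith [hr.1]⟩
  have hN : NearOneOn μ (fun p => theta α β r p / theta α β (1 - r) p) (Ioc c y) :=
    nearOneOn_theta_div hr (by ring) H₁.abs_jump_le H₂.abs_jump_le
  have hN' : NearOneOn μ (fun p => theta α β (1 - r) p / theta α β r p) (Ioc c y) :=
    nearOneOn_theta_div hr' (by ring) H₁.abs_jump_le H₂.abs_jump_le
  obtain ⟨R, hRdef⟩ : ∃ R : ℝ → ℝ, R = fun t =>
    rightLim u t * rightLim wv t - rightLim v t * rightLim wu t := ⟨_, rfl⟩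
  obtain ⟨L, hLdef⟩ : ∃ L : ℝ → ℝ, L = fun t =>
    leftLim u t * leftLim wv t - leftLim v t * leftLim wu t := ⟨_, rfl⟩
  have hlim : ∀ t ∈ EI a b, leftLim (fun z => u z * wv z - v z * wu z) t = L t := by
    intro t ht
    rw [hLdef]
    have ho := hopen t ht
    exact leftLim_eq_of_tendsto
      (((hub.1.tendsto_leftLim ho).mul (hwvb.1.tendsto_leftLim ho)).sub
        ((hvb.1.tendsto_leftLim ho).mul (hwub.1.tendsto_leftLim ho)))
  have hRL : ∀ t ∈ Ioc c y,
      L t * theta α β r t = R t * theta α β (1 - r) t := by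
    intro t ht
    have htI := hsub (Ioc_subset_Icc_self ht)
    have e1 := hub.eq_add_mul_jump htI
    have e2 := hwub.eq_add_mul_jump htI
    have e3 := hvb.eq_add_mul_jump htI
    have e4 := hwvb.eq_add_mul_jump htI
    simp only [hRdef, hLdef, theta]
    rw [e1.1, e1.2, e2.1, e2.2, e3.1, e3.2, e4.1, e4.2, H₁.jump_eq t ht, H₂.jump_eq t ht,
      H₃.jump_eq t ht, H₄.jump_eq t ht]
    ring
  have hθ₁ : ∀ t ∈ Ioc c y, theta α β (1 - r) t ≠ 0 := fun t ht =>
    (hθ t (hsub (Ioc_subset_Icc_self ht))).1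
  have hθ₂ : ∀ t ∈ Ioc c y, theta α β r t ≠ 0 := fun t ht =>
    (hθ t (hsub (Ioc_subset_Icc_self ht))).2
  have hsubx : Ioc x y ⊆ Ioc c y := Ioc_subset_Ioc_left hcx.le
  have hmain := (hN'.mono hsubx).mul_tprod_eq (R := R) (L := L) hxy.le
    (fun t ht => div_ne_zero (hθ₁ t (hsubx ht)) (hθ₂ t (hsubx ht)))
    (fun t ht => by
      have ho := hnhds t (Ioc_subset_Icc_self (hsubx ht))
      rw [hRdef, hLdef]
      exact ((tendsto_rightLim_nhdsLT (hub.1.tendsto_leftLim ho)).mul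
          (tendsto_rightLim_nhdsLT (hwvb.1.tendsto_leftLim ho))).sub
        ((tendsto_rightLim_nhdsLT (hvb.1.tendsto_leftLim ho)).mul
          (tendsto_rightLim_nhdsLT (hwub.1.tendsto_leftLim ho))))
    (fun t ht => by
      rw [mul_div_assoc', eq_div_iff (hθ₂ t (hsubx ht))]
      exact hRL t (hsubx ht))
    (fun s hs => by
      have hs' : s ∈ Ico c y := ⟨hcx.le.trans hs.1, hs.2⟩
      have ho := hnhds s (Ico_subset_Icc_self hs')
      rw [hRdef]
      exact isLittleO_wronskian_increment hs' H₁ H₂ H₃ H₄ (hub.1.tendsto_rightLim ho)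
        (hwub.1.tendsto_rightLim ho) (hvb.1.tendsto_rightLim ho) (hwvb.1.tendsto_rightLim ho))
  have hinv : (∏' p, (Ioc x y).mulIndicator (fun p => theta α β (1 - r) p / theta α β r p) p) *
      ∏' p, (Ioc x y).mulIndicator (fun p => theta α β r p / theta α β (1 - r) p) p = 1 := by
    rw [← (hN'.mono hsubx).multipliable.tprod_mul (hN.mono hsubx).multipliable]
    refine (tprod_congr fun p => ?_).trans tprod_one
    by_cases hp : p ∈ Ioc x y
    · have := hθ₁ p (hsubx hp)
      have := hθ₂ p (hsubx hp)
      rw [mulIndicator_of_mem hp, mulIndicator_of_mem hp]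
      field_simp
    · simp [hp]
  have hxc : x ∈ Ioc c y := ⟨hcx, hxy.le⟩
  have hyc : y ∈ Ioc c y := ⟨hcy, le_rfl⟩
  have hIcc : Icc x y ⊆ Ioc c y := fun t ht => ⟨hcx.trans_le ht.1, ht.2⟩
  have hprod := tprod_mulIndicator_singleton (fun p => theta α β r p / theta α β (1 - r) p)
  have hleft : ∏' p, (Icc x y).mulIndicator (fun p => theta α β r p / theta α β (1 - r) p) p =
      theta α β r x / theta α β (1 - r) x *
        ∏' p, (Ioc x y).mulIndicator (fun p => theta α β r p / theta α β (1 - r) p) p := by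
    have hE : {x} ∪ Ioc x y = Icc x y := by rw [union_comm, Ioc_union_left hxy.le]
    rw [← hE, NearOneOn.tprod_union (μ := μ) (hN.mono (hE ▸ hIcc)) (by simp), hprod]
  have hright : ∏' p, (Icc x y).mulIndicator (fun p => theta α β r p / theta α β (1 - r) p) p =
      (∏' p, (Ico x y).mulIndicator (fun p => theta α β r p / theta α β (1 - r) p) p) *
        (theta α β r y / theta α β (1 - r) y) := by
    have hE : Ico x y ∪ {y} = Icc x y := Ico_union_right hxy.le
    rw [← hE, NearOneOn.tprod_union (μ := μ) (hN.mono (hE ▸ hIcc)) (by simp), hprod]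
  have hRx : R x = L x * (theta α β r x / theta α β (1 - r) x) := by
    rw [mul_div_assoc', eq_div_iff (hθ₁ x hxc), hRL x hxc]
  have hRy : R y = L y * (theta α β r y / theta α β (1 - r) y) := by
    rw [mul_div_assoc', eq_div_iff (hθ₁ y hyc), hRL y hyc]
  rw [hlim x hx, hlim y hy,
    tprod_subtype (Ico x y) fun p => theta α β r p / theta α β (1 - r) p]
  refine mul_right_cancel₀ (div_ne_zero (hθ₂ y hyc) (hθ₁ y hyc)) ?_
  rw [mul_assoc, ← hright, hleft, ← hRy, ← mul_assoc, ← hRx, ← hmain, mul_assoc, hinv, mul_one]
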